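/- Let f : ℝ × ℝ → ℝ be C^∞ and let u be a C^∞ solution of u'(t) = f(t, u(t)) on [a,b]. Fix t ∈ [a,b), write f, f_t, f_u, f_tu, f_uu, f_uuu, f_tuu, f_ttu, f_ttt for f and its partial derivatives evaluated at (t, u(t)) and write v = u(t). Take the three-stage MQ-RBF Runge–Kutta method with a₂₁ = c₂ = 1/2, a₃₁ = 0, a₃₂ = c₃ = 3/4, b₁ = 2/9, b₂ = 1/3, b₃ = 4/9, and shape parameters ε₂² = (−(1/3)f³·f_uuu − f²·f_tuu − 4f·f_u³ − f·f_ttu − 4f_t·f_u² − (1/3)f_ttt)/(v·f·f_uu − 4v·f_u² + v·f_tu + f·f_u) and ε₃² = −ε₂²/3, assuming the denominator v·f·f_uu − 4v·f_u² + v·f_tu + f·f_u is nonzero. Then the local truncation error τ(t,h) satisfies τ(t,h) = O(h⁴) as h → 0⁺; that is, there exist C > 0 and h₀ > 0 such that |τ(t,h)| ≤ C h⁴ for all 0 < h ≤ h₀ (so the method is fourth-order accurate). -/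

import Mathlib

/-- Directional (partial) derivative of `f : ℝ × ℝ → ℝ` in the direction `d`;
`pd f (1,0) = f_t`, `pd f (0,1) = f_u`, and iterates give higher partials. -/
noncomputable def pd (f : ℝ × ℝ → ℝ) (d : ℝ × ℝ) : ℝ × ℝ → ℝ :=
  fun p => fderiv ℝ f p d

open Asymptotics Filter Topology

theorem ContDiff.pd {f : ℝ × ℝ → ℝ} (hf : ContDiff ℝ (⊤ : ℕ∞) f) (d : ℝ × ℝ) :
    ContDiff ℝ (⊤ : ℕ∞) (pd f d) :=
  (hf.fderiv_right (m := (⊤ : ℕ∞)) (by simp)).clm_apply contDiff_const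

theorem pd_comm {f : ℝ × ℝ → ℝ} (hf : ContDiff ℝ (⊤ : ℕ∞) f) (d e : ℝ × ℝ) :
    pd (pd f d) e = pd (pd f e) d := by
  have key (p d e : ℝ × ℝ) : pd (pd f d) e p = fderiv ℝ (fderiv ℝ f) p e d := by
    have h : DifferentiableAt ℝ (fderiv ℝ f) p :=
      (hf.fderiv_right (m := (⊤ : ℕ∞)) (by simp)).differentiable (by simp) p
    have h' : HasFDerivAt (pd f d) _ p := h.hasFDerivAt.clm_apply (hasFDerivAt_const d p)
    rw [pd, h'.fderiv]
    simp
  funext p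
  rw [key, key]
  exact (hf.contDiffAt.isSymmSndFDerivAt (by
    simpa using WithTop.coe_le_coe.2 (le_top : (2 : ℕ∞) ≤ ⊤))) e d

theorem hasDerivAt_comp_curve {f : ℝ × ℝ → ℝ} (hf : ContDiff ℝ (⊤ : ℕ∞) f)
    {α β : ℝ → ℝ} {α' β' x : ℝ} (hα : HasDerivAt α α' x) (hβ : HasDerivAt β β' x) :
    HasDerivAt (fun s => f (α s, β s))
      (α' * pd f (1, 0) (α x, β x) + β' * pd f (0, 1) (α x, β x)) x := by
  have h := ((hf.differentiable (by simp)) (α x, β x)).hasFDerivAt.comp_hasDerivAt x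
    (hα.prodMk hβ)
  refine h.congr_deriv ?_
  have : ((α', β') : ℝ × ℝ) = α' • (1, 0) + β' • (0, 1) := by simp
  rw [this, map_add, map_smul, map_smul]
  rfl

/-- Integrating an asymptotic bound on the derivative gains one order. -/
theorem isBigO_pow_succ_of_hasDerivWithinAt {g g' : ℝ → ℝ} {δ : ℝ} (hδ : 0 < δ)
    (hg : ∀ x ∈ Set.Icc 0 δ, HasDerivWithinAt g (g' x) (Set.Icc 0 δ) x) {k : ℕ}
    (hO : g' =O[𝓝[≥] 0] (fun h => h ^ k)) :
    (fun h => g h - g 0) =O[𝓝[≥] 0] (fun h => h ^ (k + 1)) := by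
  obtain ⟨C, hC⟩ := hO.bound
  obtain ⟨η, hη, hη'⟩ := mem_nhdsGE_iff_exists_Icc_subset.1 hC
  have hη0 : (0 : ℝ) < η := hη
  refine IsBigO.of_bound |C| ?_
  filter_upwards [Icc_mem_nhdsGE (lt_min hη0 hδ)] with h hh
  have hhη := hh.2.trans (min_le_left _ _)
  have hhδ := hh.2.trans (min_le_right _ _)
  have hb := norm_image_sub_le_of_norm_deriv_le_segment' (f := g) (f' := g') (a := 0) (b := h)
    (C := |C| * h ^ k)
    (fun x hx => (hg x ⟨hx.1, hx.2.trans hhδ⟩).mono (Set.Icc_subset_Icc_right hhδ))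
    (fun x hx => by
      have h1 : ‖g' x‖ ≤ C * ‖x ^ k‖ := hη' ⟨hx.1, hx.2.le.trans hhη⟩
      rw [Real.norm_of_nonneg (pow_nonneg hx.1 k)] at h1
      refine h1.trans ?_
      have := pow_le_pow_left₀ hx.1 hx.2.le k
      exact mul_le_mul (le_abs_self C) this (pow_nonneg hx.1 k) (abs_nonneg C))
    h ⟨hh.1, le_rfl⟩
  rw [Real.norm_of_nonneg (pow_nonneg hh.1 _)]
  rw [sub_zero, mul_assoc, ← pow_succ] at hb
  exact hb

theorem isBigO_pow_of_le {k m : ℕ} (h : k ≤ m) :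
    (fun x : ℝ => x ^ m) =O[𝓝[≥] 0] (fun x => x ^ k) := by
  refine IsBigO.of_bound 1 ?_
  filter_upwards [Icc_mem_nhdsGE (zero_lt_one (α := ℝ))] with x hx
  rw [one_mul, Real.norm_of_nonneg (pow_nonneg hx.1 _), Real.norm_of_nonneg (pow_nonneg hx.1 _)]
  exact pow_le_pow_of_le_one hx.1 hx.2 h

theorem taylor_cubic {g g₁ g₂ g₃ : ℝ → ℝ} (h₀ : ∀ x, HasDerivAt g (g₁ x) x)
    (h₁ : ∀ x, HasDerivAt g₁ (g₂ x) x) (h₂ : ∀ x, HasDerivAt g₂ (g₃ x) x)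
    (h₃ : DifferentiableAt ℝ g₃ 0) :
    (fun h => g h - (g 0 + g₁ 0 * h + g₂ 0 / 2 * h ^ 2 + g₃ 0 / 6 * h ^ 3))
      =O[𝓝[≥] 0] (fun h => h ^ 4) := by
  have e₃ : (fun h => g₃ h - g₃ 0) =O[𝓝[≥] 0] (fun h => h ^ 1) := by
    simpa using h₃.isBigO_sub.mono nhdsWithin_le_nhds
  have e₂ := isBigO_pow_succ_of_hasDerivWithinAt (g := fun h => g₂ h - g₃ 0 * h) one_pos
    (fun x _ => (((h₂ x).sub ((hasDerivAt_id x).const_mul (g₃ 0))).congr_deriv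
      (by simp)).hasDerivWithinAt) e₃
  have e₁ := isBigO_pow_succ_of_hasDerivWithinAt
    (g := fun h => g₁ h - g₂ 0 * h - g₃ 0 / 2 * h ^ 2) one_pos
    (fun x _ => ((((h₁ x).sub ((hasDerivAt_id x).const_mul (g₂ 0))).sub
      ((hasDerivAt_pow 2 x).const_mul (g₃ 0 / 2))).congr_deriv
      (by simp; ring)).hasDerivWithinAt) e₂
  have e₀ := isBigO_pow_succ_of_hasDerivWithinAt
    (g := fun h => g h - g₁ 0 * h - g₂ 0 / 2 * h ^ 2 - g₃ 0 / 6 * h ^ 3) one_pos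
    (fun x _ => (((((h₀ x).sub ((hasDerivAt_id x).const_mul (g₁ 0))).sub
      ((hasDerivAt_pow 2 x).const_mul (g₂ 0 / 2))).sub
      ((hasDerivAt_pow 3 x).const_mul (g₃ 0 / 6))).congr_deriv
      (by simp; ring)).hasDerivWithinAt) e₁
  refine e₀.congr_left fun h => ?_
  simp
  ring

/-- Third-order expansion of a smooth `f` along a perturbed cubic curve through `(t, v)`. -/
theorem isBigO_comp_curve {f : ℝ × ℝ → ℝ} (hf : ContDiff ℝ (⊤ : ℕ∞) f) (t v c q₁ q₂ q₃ : ℝ)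
    {y : ℝ → ℝ} {k : ℕ} (hk : 1 ≤ k) (hk' : k ≤ 4)
    (hy : (fun h => y h - (v + q₁ * h + q₂ * h ^ 2 + q₃ * h ^ 3)) =O[𝓝[≥] 0] (fun h => h ^ k)) :
    (fun h => f (t + c * h, y h) - (f (t, v) +
      (c * pd f (1, 0) (t, v) + q₁ * pd f (0, 1) (t, v)) * h +
      (q₂ * pd f (0, 1) (t, v) + (c ^ 2 * pd (pd f (1, 0)) (1, 0) (t, v) +
        2 * c * q₁ * pd (pd f (1, 0)) (0, 1) (t, v) +
        q₁ ^ 2 * pd (pd f (0, 1)) (0, 1) (t, v)) / 2) * h ^ 2 +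
      (q₃ * pd f (0, 1) (t, v) + c * q₂ * pd (pd f (1, 0)) (0, 1) (t, v) +
        q₁ * q₂ * pd (pd f (0, 1)) (0, 1) (t, v) +
        (c ^ 3 * pd (pd (pd f (1, 0)) (1, 0)) (1, 0) (t, v) +
        3 * c ^ 2 * q₁ * pd (pd (pd f (1, 0)) (1, 0)) (0, 1) (t, v) +
        3 * c * q₁ ^ 2 * pd (pd (pd f (1, 0)) (0, 1)) (0, 1) (t, v) +
        q₁ ^ 3 * pd (pd (pd f (0, 1)) (0, 1)) (0, 1) (t, v)) / 6) * h ^ 3))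
      =O[𝓝[≥] 0] (fun h => h ^ k) := by
  set α : ℝ → ℝ := fun h => t + c * h with hα
  set β : ℝ → ℝ := fun h => v + q₁ * h + q₂ * h ^ 2 + q₃ * h ^ 3 with hβ
  set β₁ : ℝ → ℝ := fun h => q₁ + 2 * q₂ * h + 3 * q₃ * h ^ 2 with hβ₁
  set β₂ : ℝ → ℝ := fun h => 2 * q₂ + 6 * q₃ * h with hβ₂
  have dα (x : ℝ) : HasDerivAt α c x := 
    (((hasDerivAt_id x).const_mul c).const_add t).congr_deriv (by simp)
  have dβ (x : ℝ) : HasDerivAt β (β₁ x) x :=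
    (((((hasDerivAt_id x).const_mul q₁).const_add v).add
      ((hasDerivAt_pow 2 x).const_mul q₂)).add ((hasDerivAt_pow 3 x).const_mul q₃)).congr_deriv
      (by simp [hβ₁]; ring)
  have dβ₁ (x : ℝ) : HasDerivAt β₁ (β₂ x) x :=
    ((((hasDerivAt_id x).const_mul (2 * q₂)).const_add q₁).add
      ((hasDerivAt_pow 2 x).const_mul (3 * q₃))).congr_deriv (by simp [hβ₂]; ring)
  have dβ₂ (x : ℝ) : HasDerivAt β₂ (6 * q₃) x := 
    (((hasDerivAt_id x).const_mul (6 * q₃)).const_add (2 * q₂)).congr_deriv (by simp)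
  have L {w : ℝ × ℝ → ℝ} (hw : ContDiff ℝ (⊤ : ℕ∞) w) (x : ℝ) :=
    hasDerivAt_comp_curve hw (dα x) (dβ x)
  have ct := hf.pd (1, 0)
  have cu := hf.pd (0, 1)
  have ctt := ct.pd (1, 0)
  have ctu := ct.pd (0, 1)
  have cuu := cu.pd (0, 1)
  have s₁ : pd (pd f (0, 1)) (1, 0) = pd (pd f (1, 0)) (0, 1) := pd_comm hf _ _
  have s₂ : pd (pd (pd f (1, 0)) (0, 1)) (1, 0) = pd (pd (pd f (1, 0)) (1, 0)) (0, 1) :=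
    pd_comm ct _ _
  have s₃ : pd (pd (pd f (0, 1)) (0, 1)) (1, 0) = pd (pd (pd f (1, 0)) (0, 1)) (0, 1) := by
    rw [pd_comm cu, s₁]
  have T := taylor_cubic (L hf)
    (fun x => ((L ct x).const_mul c).add ((dβ₁ x).mul (L cu x)))
    (fun x => (((((L ctt x).const_mul c).add ((dβ₁ x).mul (L ctu x))).const_mul c).add
      (((dβ₂ x).mul (L cu x)).add ((dβ₁ x).mul
        (((L (cu.pd (1, 0)) x).const_mul c).add ((dβ₁ x).mul (L cuu x)))))))
    (by
      have d {w : ℝ × ℝ → ℝ} (hw : ContDiff ℝ (⊤ : ℕ∞) w) :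
          DifferentiableAt ℝ (fun x => w (α x, β x)) 0 := (L hw 0).differentiableAt
      have d₁ := (dβ₁ 0).differentiableAt
      have d₂ := (dβ₂ 0).differentiableAt
      have := d cu
      have := d ctu
      have := d cuu
      have := d (ctt.pd (1, 0))
      have := d (ctt.pd (0, 1))
      have := d (ctu.pd (0, 1))
      have := d (cuu.pd (0, 1))
      simp only [s₁, s₂, s₃]
      fun_prop)
  have hlip : (fun h => f (α h, y h) - f (α h, β h)) =O[𝓝[≥] 0] (fun h => h ^ k) := by
    have hS := ((hf.contDiffAt (x := (t, v))).hasStrictFDerivAt (by simp)).isBigO_sub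
    have tα : Tendsto α (𝓝[≥] 0) (𝓝 t) := by
      simpa [hα] using (dα 0).continuousAt.tendsto.mono_left nhdsWithin_le_nhds
    have tβ : Tendsto β (𝓝[≥] 0) (𝓝 v) := by
      simpa [hβ] using (dβ 0).continuousAt.tendsto.mono_left nhdsWithin_le_nhds
    have tpow : Tendsto (fun h : ℝ => h ^ k) (𝓝[≥] 0) (𝓝 0) := by
      have := ((continuous_pow k).tendsto (0 : ℝ)).mono_left
        (nhdsWithin_le_nhds (s := Set.Ici 0))
      rwa [zero_pow (by omega)] at this
    have ty : Tendsto y (𝓝[≥] 0) (𝓝 v) := by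
      simpa [hβ] using (hy.trans_tendsto tpow).add tβ
    refine (hS.comp_tendsto ((tα.prodMk_nhds ty).prodMk_nhds (tα.prodMk_nhds tβ))).trans ?_
    refine (IsBigO.of_bound 1 (Eventually.of_forall fun h => ?_)).trans hy
    simp [Prod.norm_def, hβ]
  refine (hlip.add (T.trans (isBigO_pow_of_le hk'))).congr_left fun h => ?_
  simp only [s₁, s₂, s₃, hα, hβ, hβ₁, hβ₂]
  simp
  ring

theorem isBigO_sqrt_one_add (e : ℝ) :
    (fun h : ℝ => Real.sqrt (1 + e * h ^ 2) - (1 + e / 2 * h ^ 2)) =O[𝓝[≥] 0]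
      (fun h => h ^ 4) := by
  have hpos : ∀ᶠ h : ℝ in 𝓝[≥] 0, 0 < 1 + e * h ^ 2 := by
    have : Tendsto (fun h : ℝ => 1 + e * h ^ 2) (𝓝[≥] 0) (𝓝 (1 + e * 0 ^ 2)) :=
      (Continuous.tendsto (by fun_prop) 0).mono_left nhdsWithin_le_nhds
    exact this.eventually (lt_mem_nhds (by simp))
  refine IsBigO.of_bound (e ^ 2 / 2) ?_
  filter_upwards [hpos] with h hh
  have h1 := Real.sq_sqrt hh.le
  have h0 := Real.sqrt_nonneg (1 + e * h ^ 2)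
  set s := Real.sqrt (1 + e * h ^ 2)
  have h2 : s - (1 + e / 2 * h ^ 2) = -((s - 1) ^ 2 / 2) := by linear_combination h1 / 2
  have h3 : (e * h ^ 2) ^ 2 = (s - 1) ^ 2 * (s + 1) ^ 2 := by
    rw [show e * h ^ 2 = s ^ 2 - 1 by linarith]
    ring
  rw [h2, norm_neg, Real.norm_of_nonneg (by positivity), Real.norm_of_nonneg (by positivity)]
  nlinarith [mul_nonneg (sq_nonneg (s - 1)) (by positivity : 0 ≤ s ^ 2 + 2 * s)]

theorem isBigO_quadratic_of_cubic {g : ℝ → ℝ} {r₀ r₁ r₂ r₃ : ℝ}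
    (hg : (fun h => g h - (r₀ + r₁ * h + r₂ * h ^ 2 + r₃ * h ^ 3)) =O[𝓝[≥] 0]
      (fun h => h ^ 4)) :
    (fun h => g h - (r₀ + r₁ * h + r₂ * h ^ 2)) =O[𝓝[≥] 0] (fun h => h ^ 3) :=
  ((hg.trans (isBigO_pow_of_le (by norm_num))).add
    ((isBigO_refl (fun h : ℝ => h ^ 3) _).const_mul_left r₃)).congr_left fun h => by ring

/-- Cubic expansion of an MQ-RBF stage value, given a quadratic expansion of its slope. -/
theorem isBigO_stage_value (v c e r₀ r₁ r₂ : ℝ) {k : ℝ → ℝ}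
    (hk : (fun h => k h - (r₀ + r₁ * h + r₂ * h ^ 2)) =O[𝓝[≥] 0] (fun h => h ^ 3)) :
    (fun h => (v + h * (c * k h)) * Real.sqrt (1 + e * h ^ 2) -
      (v + c * r₀ * h + (c * r₁ + v * e / 2) * h ^ 2 +
        (c * r₂ + c * r₀ * e / 2) * h ^ 3)) =O[𝓝[≥] 0] (fun h => h ^ 4) := by
  have b {p : ℝ → ℝ} (hp : Continuous p) : p =O[𝓝[≥] 0] (fun _ => (1 : ℝ)) :=
    (hp.tendsto 0).isBigO_one ℝ |>.mono nhdsWithin_le_nhds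
  have hs := isBigO_sqrt_one_add e
  have h₁ : (fun h => (c * Real.sqrt (1 + e * h ^ 2)) *
      (h * (k h - (r₀ + r₁ * h + r₂ * h ^ 2)))) =O[𝓝[≥] 0] (fun h : ℝ => 1 * (h * h ^ 3)) :=
    (b (by fun_prop)).mul ((isBigO_refl _ _).mul hk)
  have h₂ : (fun h => (v + h * (c * (r₀ + r₁ * h + r₂ * h ^ 2))) *
      (Real.sqrt (1 + e * h ^ 2) - (1 + e / 2 * h ^ 2))) =O[𝓝[≥] 0]
      (fun h : ℝ => 1 * h ^ 4) := (b (by fun_prop)).mul hs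
  have h₃ : (fun h : ℝ => (c * r₁ * e / 2 + c * r₂ * e / 2 * h) * h ^ 4) =O[𝓝[≥] 0]
      (fun h : ℝ => 1 * h ^ 4) := (b (by fun_prop)).mul (isBigO_refl _ _)
  refine (((h₁.congr_right (g₂ := fun h => h ^ 4) fun h => by ring).add
    (h₂.congr_right fun h => by ring)).add
    (h₃.congr_right fun h => by ring)).congr_left fun h => ?_
  ring

/-- Fourth-order Taylor expansion of a solution of `u' = f(t, u)`. -/
theorem isBigO_ode_solution {f : ℝ × ℝ → ℝ} (hf : ContDiff ℝ (⊤ : ℕ∞) f) {a b : ℝ} {u : ℝ → ℝ}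
    (hode : ∀ s ∈ Set.Icc a b, HasDerivWithinAt u (f (s, u s)) (Set.Icc a b) s)
    {t : ℝ} (ht : t ∈ Set.Ico a b) {F ft fu ftt ftu fuu q₂ q₃ : ℝ}
    (hF : F = f (t, u t)) (hft : ft = pd f (1, 0) (t, u t)) (hfu : fu = pd f (0, 1) (t, u t))
    (hftt : ftt = pd (pd f (1, 0)) (1, 0) (t, u t))
    (hftu : ftu = pd (pd f (1, 0)) (0, 1) (t, u t))
    (hfuu : fuu = pd (pd f (0, 1)) (0, 1) (t, u t))
    (hq₂ : q₂ = (ft + F * fu) / 2)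
    (hq₃ : q₃ = (q₂ * fu + (ftt + 2 * F * ftu + F ^ 2 * fuu) / 2) / 3) :
    (fun h => u (t + h) - (u t + F * h + q₂ * h ^ 2 + q₃ * h ^ 3 +
      (q₃ * fu + q₂ * ftu + F * q₂ * fuu +
        (pd (pd (pd f (1, 0)) (1, 0)) (1, 0) (t, u t) +
        3 * F * pd (pd (pd f (1, 0)) (1, 0)) (0, 1) (t, u t) +
        3 * F ^ 2 * pd (pd (pd f (1, 0)) (0, 1)) (0, 1) (t, u t) +
        F ^ 3 * pd (pd (pd f (0, 1)) (0, 1)) (0, 1) (t, u t)) / 6) / 4 * h ^ 4))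
      =O[𝓝[≥] 0] (fun h => h ^ 5) := by
  set r := q₃ * fu + q₂ * ftu + F * q₂ * fuu +
        (pd (pd (pd f (1, 0)) (1, 0)) (1, 0) (t, u t) +
        3 * F * pd (pd (pd f (1, 0)) (1, 0)) (0, 1) (t, u t) +
        3 * F ^ 2 * pd (pd (pd f (1, 0)) (0, 1)) (0, 1) (t, u t) +
        F ^ 3 * pd (pd (pd f (0, 1)) (0, 1)) (0, 1) (t, u t)) / 6 with hr
  have hδ : 0 < b - t := sub_pos.2 ht.2
  have hd (x : ℝ) (hx : x ∈ Set.Icc 0 (b - t)) : HasDerivWithinAt (fun h => u (t + h))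
      (f (t + x, u (t + x))) (Set.Icc 0 (b - t)) x := by
    have hm : Set.MapsTo (fun h => t + h) (Set.Icc 0 (b - t)) (Set.Icc a b) := fun z hz =>
      ⟨by linarith [ht.1, hz.1], by linarith [hz.2]⟩
    exact ((hode (t + x) (hm hx)).comp x
      ((hasDerivAt_id x).const_add t).hasDerivWithinAt hm).congr_deriv (by simp)
  have step {k : ℕ} (hk : 1 ≤ k) (hk' : k ≤ 4)
      (hy : (fun h => u (t + h) - (u t + F * h + q₂ * h ^ 2 + q₃ * h ^ 3))
        =O[𝓝[≥] 0] (fun h => h ^ k)) :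
      (fun h => u (t + h) - (u t + F * h + q₂ * h ^ 2 + q₃ * h ^ 3 + r / 4 * h ^ 4))
        =O[𝓝[≥] 0] (fun h => h ^ (k + 1)) := by
    have hc := isBigO_comp_curve hf t (u t) 1 F q₂ q₃ hk hk' hy
    have hp (x : ℝ) : HasDerivAt (fun h : ℝ => F * h + q₂ * h ^ 2 + q₃ * h ^ 3 + r / 4 * h ^ 4)
        (F + 2 * q₂ * x + 3 * q₃ * x ^ 2 + r * x ^ 3) x :=
      (((((hasDerivAt_id x).const_mul F).add ((hasDerivAt_pow 2 x).const_mul q₂)).add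
        ((hasDerivAt_pow 3 x).const_mul q₃)).add
        ((hasDerivAt_pow 4 x).const_mul (r / 4))).congr_deriv (by simp; ring)
    have := isBigO_pow_succ_of_hasDerivWithinAt hδ
      (fun x hx => (hd x hx).sub (hp x).hasDerivWithinAt) (hc.congr_left fun h => by
        rw [← hF, ← hft, ← hfu, ← hftt, ← hftu, ← hfuu, one_mul, hr, hq₃, hq₂]
        ring)
    refine this.congr_left fun h => ?_
    simp
    ring
  have drop {k : ℕ} (hk : k ≤ 4)
      (hy : (fun h => u (t + h) - (u t + F * h + q₂ * h ^ 2 + q₃ * h ^ 3 + r / 4 * h ^ 4))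
        =O[𝓝[≥] 0] (fun h => h ^ k)) :
      (fun h => u (t + h) - (u t + F * h + q₂ * h ^ 2 + q₃ * h ^ 3))
        =O[𝓝[≥] 0] (fun h => h ^ k) :=
    (hy.add ((isBigO_pow_of_le hk).const_mul_left (r / 4))).congr_left fun h => by ring
  have base : (fun h => u (t + h) - (u t + F * h + q₂ * h ^ 2 + q₃ * h ^ 3))
      =O[𝓝[≥] 0] (fun h => h ^ 1) := by
    have h₁ := (hd 0 ⟨le_rfl, hδ.le⟩).differentiableWithinAt.isBigO_sub
    rw [nhdsWithin_Icc_eq_nhdsGE hδ] at h₁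
    have h₂ : DifferentiableAt ℝ (fun h : ℝ => F * h + q₂ * h ^ 2 + q₃ * h ^ 3) 0 := by fun_prop
    refine ((h₁.sub (h₂.isBigO_sub.mono nhdsWithin_le_nhds)).congr_left fun h => ?_).congr_right
      fun h => ?_
    · simp
      ring
    · simp
  exact step (by norm_num) le_rfl (drop le_rfl (step (by norm_num) (by norm_num)
    (drop (by norm_num) (step (by norm_num) (by norm_num)
      (drop (by norm_num) (step le_rfl (by norm_num) base))))))

/-- Fourth-order accuracy of the three-stage MQ-RBF Runge–Kutta method (case III):
`a₂₁ = c₂ = 1/2`, `a₃₁ = 0`, `a₃₂ = c₃ = 3/4`, `b₁ = 2/9`, `b₂ = 1/3`, `b₃ = 4/9`,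
shape parameters
`ε₂² = (−(1/3)f³ f_uuu − f² f_tuu − 4f f_u³ − f f_ttu − 4f_t f_u² − (1/3)f_ttt)
      /(v f f_uu − 4v f_u² + v f_tu + f f_u)` and `ε₃² = −ε₂²/3` (denominator nonzero);
then the local truncation error is `O(h⁴)` as `h → 0⁺`. -/
theorem mq_rk3_fourth_order_III
    (a b : ℝ) (hab : a < b) (f : ℝ × ℝ → ℝ) (hf : ContDiff ℝ (⊤ : ℕ∞) f)
    (u : ℝ → ℝ) (hu : ContDiffOn ℝ (⊤ : ℕ∞) u (Set.Icc a b))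
    (hode : ∀ s ∈ Set.Icc a b, HasDerivWithinAt u (f (s, u s)) (Set.Icc a b) s)
    (t : ℝ) (ht : t ∈ Set.Ico a b) :
    let v := u t
    let F := f (t, v)
    let ft := pd f (1, 0) (t, v)
    let fu := pd f (0, 1) (t, v)
    let ftu := pd (pd f (1, 0)) (0, 1) (t, v)
    let fuu := pd (pd f (0, 1)) (0, 1) (t, v)
    let fuuu := pd (pd (pd f (0, 1)) (0, 1)) (0, 1) (t, v)
    let ftuu := pd (pd (pd f (1, 0)) (0, 1)) (0, 1) (t, v)
    let fttu := pd (pd (pd f (1, 0)) (1, 0)) (0, 1) (t, v)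
    let fttt := pd (pd (pd f (1, 0)) (1, 0)) (1, 0) (t, v)
    let den := v * F * fuu - 4 * v * fu ^ 2 + v * ftu + F * fu
    let eps2 := (-(1 / 3) * F ^ 3 * fuuu - F ^ 2 * ftuu - 4 * F * fu ^ 3 - F * fttu -
      4 * ft * fu ^ 2 - (1 / 3) * fttt) / den
    let eps3 := -eps2 / 3
    den ≠ 0 →
    ∃ C > 0, ∃ h₀ > 0, ∀ h : ℝ, 0 < h → h ≤ h₀ →
      let k1 := F
      let k2 := f (t + (1 / 2) * h,
        (v + h * (1 / 2) * k1) * Real.sqrt (1 + eps2 * (1 / 2) ^ 2 * h ^ 2))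
      let k3 := f (t + (3 / 4) * h,
        (v + h * (0 * k1 + (3 / 4) * k2)) *
          Real.sqrt (1 + eps3 * (3 / 4) ^ 2 * h ^ 2))
      |(u (t + h) - u t) / h - ((2 / 9) * k1 + (1 / 3) * k2 + (4 / 9) * k3)| ≤
        C * h ^ 4 := by
  intro v F ft fu ftu fuu fuuu ftuu fttu fttt den eps2 eps3 hden
  have hE : eps2 * den = -(1 / 3) * F ^ 3 * fuuu - F ^ 2 * ftuu - 4 * F * fu ^ 3 - F * fttu -
      4 * ft * fu ^ 2 - (1 / 3) * fttt := div_mul_cancel₀ _ hden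
  set ftt := pd (pd f (1, 0)) (1, 0) (t, v) with hftt
  have hu4 := isBigO_ode_solution hf hode ht (F := F) (ft := ft) (fu := fu) (ftt := ftt)
    (ftu := ftu) (fuu := fuu) rfl rfl rfl rfl rfl rfl rfl rfl
  have hy2 := isBigO_stage_value v (1 / 2) (eps2 * (1 / 2) ^ 2) F 0 0 (k := fun _ => F)
    ((isBigO_zero _ _).congr_left fun h => by ring)
  have hk2 := isBigO_comp_curve hf t v (1 / 2) _ _ _ (by norm_num) le_rfl hy2
  have hy3 := isBigO_stage_value v (3 / 4) (eps3 * (3 / 4) ^ 2) _ _ _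
    (isBigO_quadratic_of_cubic hk2)
  have hk3 := isBigO_comp_curve hf t v (3 / 4) _ _ _ (by norm_num) le_rfl hy3
  have hΦ := (isBigO_refl (fun h : ℝ => h) (𝓝[≥] 0)).mul
    ((hk2.const_mul_left (1 / 3)).add (hk3.const_mul_left (4 / 9)))
  have hτ := hu4.sub (hΦ.congr_right (g₂ := fun h => h ^ 5) fun h => by ring)
  obtain ⟨C, hC, hb⟩ := hτ.exists_pos
  obtain ⟨h₀, hh₀, hsub⟩ := mem_nhdsGE_iff_exists_Icc_subset.1 hb.bound
  refine ⟨C, hC, h₀, hh₀, fun h hpos hle => ?_⟩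
  have hbound := hsub (show h ∈ Set.Icc 0 h₀ from ⟨hpos.le, hle⟩)
  intro k1 k2 k3
  have e2 : f (t + 1 / 2 * h, (v + h * (1 / 2 * F)) *
      Real.sqrt (1 + eps2 * (1 / 2) ^ 2 * h ^ 2)) = k2 := by
    simp only [k2, k1, mul_assoc]
  have e3 : f (t + 3 / 4 * h, (v + h * (3 / 4 * k2)) *
      Real.sqrt (1 + eps3 * (3 / 4) ^ 2 * h ^ 2)) = k3 := by
    simp only [k3, zero_mul, zero_add]
  have hS : (u (t + h) - u t) - h * ((2 / 9) * k1 + (1 / 3) * k2 + (4 / 9) * k3) =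
      ((u (t + h) - u t) / h - ((2 / 9) * k1 + (1 / 3) * k2 + (4 / 9) * k3)) * h := by
    field_simp
  simp only [Set.mem_ofPred_eq] at hbound
  rw [e2, e3, ← hftt] at hbound
  have key : ‖(u (t + h) - u t) - h * ((2 / 9) * k1 + (1 / 3) * k2 + (4 / 9) * k3)‖ ≤
      C * ‖h ^ 5‖ := by
    refine le_of_eq_of_le (congrArg norm ?_) hbound
    change u (t + h) - v - h * ((2 / 9) * F + (1 / 3) * k2 + (4 / 9) * k3) = _
    rw [show u t = v from rfl, show f (t, v) = F from rfl,
      show pd f (1, 0) (t, v) = ft from rfl, show pd f (0, 1) (t, v) = fu from rfl,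
      show pd (pd f (1, 0)) (0, 1) (t, v) = ftu from rfl,
      show pd (pd f (0, 1)) (0, 1) (t, v) = fuu from rfl,
      show pd (pd (pd f (0, 1)) (0, 1)) (0, 1) (t, v) = fuuu from rfl,
      show pd (pd (pd f (1, 0)) (0, 1)) (0, 1) (t, v) = ftuu from rfl,
      show pd (pd (pd f (1, 0)) (1, 0)) (0, 1) (t, v) = fttu from rfl,
      show pd (pd (pd f (1, 0)) (1, 0)) (1, 0) (t, v) = fttt from rfl,
      show eps3 = -eps2 / 3 from rfl]
    simp only [den] at hE
    clear_value k2 k3 eps2 fuuu ftuu fttu fttt ftu fuu ft fu ftt F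
    linear_combination (h ^ 4 / 96) * hE
  rw [hS, norm_mul, Real.norm_eq_abs, Real.norm_of_nonneg hpos.le,
    Real.norm_of_nonneg (by positivity), pow_succ, ← mul_assoc] at key
  exact le_of_mul_le_mul_right key hpos
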